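/- Let F = (V+r, E) be a flame with root r such that ϱ_F(v) = k for every vertex v ∈ V, where k ≥ 1. Then E is the union of k pairwise edge-disjoint arborescences of F rooted at r, each spanning V+r. -/

import Mathlib

/- Common setup: a rooted digraph `D = (V+r, E)` is modelled as a finite
vertex type `α` (whose elements are `V ∪ {r}`), a finite edge type `E`
(allowing parallel edges, i.e. a multigraph) and maps `tail head : E → α`.
Subgraphs / edge subsets are sets `F : Set E`; the whole digraph `D`
corresponds to the edge set `Set.univ`.  "`v ∈ V`" is rendered as `v ≠ r`,
and a vertex subset `X ⊆ V` as `X : Set α` with `r ∉ X`. -/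

/-- In-degree of the vertex `v` in the digraph with edge set `F`. -/
noncomputable def inDeg {α E : Type*} (head : E → α) (F : Set E) (v : α) : ℕ :=
  {e ∈ F | head e = v}.ncard

/-- `ϱ_F(X)`: the number of edges of `F` entering the vertex set `X`
(tail outside `X`, head in `X`). -/
noncomputable def rho {α E : Type*} (tail head : E → α) (F : Set E) (X : Set α) : ℕ :=
  {e ∈ F | tail e ∉ X ∧ head e ∈ X}.ncard

/-- `p` is a directed path from `r` to `v` using edges of `F`:
a nonempty list of consecutive edges, starting at `r`, ending at `v`, and
visiting pairwise distinct vertices. -/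
def IsRVPath {α E : Type*} (tail head : E → α) (F : Set E) (r v : α) (p : List E) : Prop :=
  (∀ e ∈ p, e ∈ F) ∧
  List.Chain' (fun e f => head e = tail f) p ∧
  (p.map tail).Nodup ∧ (∀ e ∈ p, tail e ≠ v) ∧
  (∃ e, p.head? = some e ∧ tail e = r) ∧
  (∃ e, p.getLast? = some e ∧ head e = v)

/-- There exist `n` pairwise edge-disjoint directed paths from `r` to `v`
in the edge set `F`. -/
def HasEDPaths {α E : Type*} (tail head : E → α) (F : Set E) (r v : α) (n : ℕ) : Prop :=
  ∃ P : Fin n → List E, (∀ i, IsRVPath tail head F r v (P i)) ∧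
    ∀ i j, i ≠ j → ∀ e, e ∈ P i → e ∉ P j

/-- `λ_F(r,v)`: the local edge-connectivity from `r` to `v`, i.e. the maximum
number of pairwise edge-disjoint directed paths from `r` to `v` in `F`. -/
noncomputable def lam {α E : Type*} (tail head : E → α) (F : Set E) (r v : α) : ℕ :=
  sSup {n | HasEDPaths tail head F r v n}

/-- `X` is a `v`-tight vertex set in the digraph with edge set `F` and root `r`:
`X ⊆ V` (i.e. `r ∉ X`), `v ∈ X` and `ϱ_F(X) = λ_F(r,v)`. -/
def Tight {α E : Type*} (tail head : E → α) (F : Set E) (r v : α) (X : Set α) : Prop :=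
  v ∈ X ∧ r ∉ X ∧ rho tail head F X = lam tail head F r v

/-- The digraph with edge set `F` is a flame with root `r`:
`λ_F(r,v) = ϱ_F(v)` for every `v ∈ V`. -/
def IsFlame {α E : Type*} (tail head : E → α) (F : Set E) (r : α) : Prop :=
  ∀ v, v ≠ r → lam tail head F r v = inDeg head F v

/-- `F` is a maximal flame within the ambient edge set `A`:
`λ_A(r,v) = λ_F(r,v) = ϱ_F(v)` for every `v ∈ V`. -/
def IsMaxFlameIn {α E : Type*} (tail head : E → α) (A : Set E) (r : α) (F : Set E) : Prop :=
  F ⊆ A ∧ ∀ v, v ≠ r →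
    lam tail head A r v = lam tail head F r v ∧
    lam tail head F r v = inDeg head F v

/-- A closed directed walk in `F` with pairwise distinct edges.  (If every
vertex is entered by at most one edge of `F`, the existence of such a walk is
equivalent to the existence of an undirected cycle in `F`.) -/
def IsDicycle {α E : Type*} (tail head : E → α) (F : Set E) (p : List E) : Prop :=
  p.Nodup ∧ (∀ e ∈ p, e ∈ F) ∧
  List.Chain' (fun e f => head e = tail f) p ∧
  (∃ e f, p.head? = some e ∧ p.getLast? = some f ∧ head f = tail e)

/-- `B` is a branching: every vertex is entered by at most one edge of `B` and,
disregarding edge directions, `B` contains no cycle (under the in-degree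
condition this is equivalent to containing no directed cycle). -/
def IsBranching {α E : Type*} (tail head : E → α) (B : Set E) : Prop :=
  (∀ v, inDeg head B v ≤ 1) ∧ ∀ p : List E, ¬ IsDicycle tail head B p

/-- The head-set of an edge set `B`: the vertices entered by an edge of `B`. -/
def headSet {α E : Type*} (head : E → α) (B : Set E) : Set α := {v | ∃ e ∈ B, head e = v}

/-- Independence in the gammoid `G_D(v)` (with `D` the whole digraph, edge set
`Set.univ`): `X ⊆ in_D(v)` is independent if there are `|X|` pairwise
edge-disjoint directed paths from `r` to `v` in `D` whose set of last edges is
exactly `X`. -/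
def GammoidIndep {α E : Type*} (tail head : E → α) (r v : α) (X : Set E) : Prop :=
  ∃ P : Fin X.ncard → List E,
    (∀ i, IsRVPath tail head Set.univ r v (P i)) ∧
    (∀ i j, i ≠ j → ∀ e, e ∈ P i → e ∉ P j) ∧
    (∀ e, e ∈ X ↔ ∃ i, (P i).getLast? = some e)

section Edmonds

variable {α E : Type*} {tail head : E → α} {r : α}

/-- The edge set `B` is an arborescence rooted at `r` with vertex set `U`; acyclicity is witnessed
by a height function that increases along every edge. -/
structure IsArborescenceOn (tail head : E → α) (r : α) (U : Set α) (B : Set E) : Prop where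
  root_mem : r ∈ U
  tail_mem : ∀ e ∈ B, tail e ∈ U
  head_mem : ∀ e ∈ B, head e ∈ U
  head_ne_root : ∀ e ∈ B, head e ≠ r
  existsUnique_edge : ∀ v ∈ U, v ≠ r → ∃! e, e ∈ B ∧ head e = v
  exists_height : ∃ d : α → ℕ, ∀ e ∈ B, d (tail e) < d (head e)

lemma isArborescenceOn_singleton_root : IsArborescenceOn tail head r {r} ∅ where
  root_mem := rfl
  tail_mem _ he := he.elim
  head_mem _ he := he.elim
  head_ne_root _ he := he.elim
  existsUnique_edge _ hv hne := (hne hv).elim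
  exists_height := ⟨fun _ => 0, fun _ he => he.elim⟩

lemma IsArborescenceOn.insert_edge {U : Set α} {B : Set E} (h : IsArborescenceOn tail head r U B)
    {e : E} (ht : tail e ∈ U) (hh : head e ∉ U) :
    IsArborescenceOn tail head r (insert (head e) U) (insert e B) where
  root_mem := Or.inr h.root_mem
  tail_mem := by
    rintro f (rfl | hf)
    exacts [Or.inr ht, Or.inr (h.tail_mem f hf)]
  head_mem := by
    rintro f (rfl | hf)
    exacts [Or.inl rfl, Or.inr (h.head_mem f hf)]
  head_ne_root := by
    rintro f (rfl | hf)
    exacts [fun hr => hh (hr ▸ h.root_mem), h.head_ne_root f hf]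
  existsUnique_edge := by
    rintro v (rfl | hv) hvr
    · refine ⟨e, ⟨Or.inl rfl, rfl⟩, ?_⟩
      rintro f ⟨rfl | hf, hfe⟩
      exacts [rfl, (hh (hfe ▸ h.head_mem f hf)).elim]
    · obtain ⟨f, ⟨hf, rfl⟩, huniq⟩ := h.existsUnique_edge v hv hvr
      refine ⟨f, ⟨Or.inr hf, rfl⟩, ?_⟩
      rintro g ⟨rfl | hg, hgf⟩
      exacts [(hh (hgf ▸ hv)).elim, huniq g ⟨hg, hgf⟩]
  exists_height := by
    classical
    obtain ⟨d, hd⟩ := h.exists_height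
    refine ⟨Function.update d (head e) (d (tail e) + 1), ?_⟩
    have hU : ∀ v ∈ U, Function.update d (head e) (d (tail e) + 1) v = d v := fun v hv =>
      Function.update_of_ne (ne_of_mem_of_not_mem hv hh) _ _
    rintro f (rfl | hf)
    · rw [hU _ ht, Function.update_self]
      exact Nat.lt_succ_self _
    · rw [hU _ (h.tail_mem f hf), hU _ (h.head_mem f hf)]
      exact hd f hf

lemma height_tail_lt_height_head {d : α → ℕ} : ∀ {p : List E} {e f : E},
    (∀ g ∈ p, d (tail g) < d (head g)) → p.IsChain (fun e f => head e = tail f) →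
    p.head? = some e → p.getLast? = some f → d (tail e) < d (head f)
  | [], _, _, _, _, he, _ => by simp at he
  | [a], _, _, hd, _, he, hf => by
    simp only [List.head?_cons, List.getLast?_singleton, Option.some.injEq] at he hf
    subst he hf
    exact hd a (by simp)
  | a :: b :: p, e, f, hd, hc, he, hf => by
    rw [List.isChain_cons_cons] at hc
    simp only [List.head?_cons, Option.some.injEq] at he
    rw [List.getLast?_cons_cons] at hf
    subst he
    have h1 := hd a (by simp)
    have h2 := height_tail_lt_height_head (p := b :: p) (e := b)
      (fun g hg => hd g (List.mem_cons_of_mem _ hg)) hc.2 rfl hf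
    rw [← hc.1] at h2
    exact h1.trans h2

lemma IsArborescenceOn.not_isDicycle {U : Set α} {B : Set E}
    (h : IsArborescenceOn tail head r U B) (p : List E) : ¬ IsDicycle tail head B p := by
  rintro ⟨-, hB, hc, e, f, he, hf, hfe⟩
  obtain ⟨d, hd⟩ := h.exists_height
  have hlt := height_tail_lt_height_head (fun g hg => hd g (hB g hg)) hc he hf
  rw [hfe] at hlt
  exact hlt.false

lemma IsArborescenceOn.inDeg_eq_one {U : Set α} {B : Set E}
    (h : IsArborescenceOn tail head r U B) {v : α} (hv : v ∈ U) (hvr : v ≠ r) :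
    inDeg head B v = 1 := by
  obtain ⟨e, he, huniq⟩ := h.existsUnique_edge v hv hvr
  exact Set.ncard_eq_one.2 ⟨e, Set.ext fun f => ⟨huniq f, fun hf => hf ▸ he⟩⟩

lemma IsArborescenceOn.inDeg_root {U : Set α} {B : Set E}
    (h : IsArborescenceOn tail head r U B) : inDeg head B r = 0 := by
  have : {e ∈ B | head e = r} = ∅ :=
    Set.eq_empty_of_forall_notMem fun e he => h.head_ne_root e he.1 he.2
  rw [inDeg, this, Set.ncard_empty]

/-- The in-degree function on vertex sets is submodular. -/
lemma rho_inter_add_rho_union_le [Finite E] (F : Set E) (X Y : Set α) :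
    rho tail head F (X ∩ Y) + rho tail head F (X ∪ Y) ≤
      rho tail head F X + rho tail head F Y := by
  unfold rho
  rw [← Set.ncard_union_add_ncard_inter, ← Set.ncard_union_add_ncard_inter {e ∈ F | _ ∧ head e ∈ X}]
  refine add_le_add (Set.ncard_le_ncard fun e he => ?_) (Set.ncard_le_ncard fun e he => ?_)
  · simp only [Set.mem_union, Set.mem_inter_iff, Set.mem_ofPred_eq] at he ⊢
    tauto
  · simp only [Set.mem_union, Set.mem_inter_iff, Set.mem_ofPred_eq] at he ⊢
    tauto

lemma rho_le_rho_sdiff_singleton_add_one [Finite E] (F : Set E) (X : Set α) (e : E) :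
    rho tail head F X ≤ rho tail head (F \ {e}) X + 1 := by
  unfold rho
  refine (Set.ncard_le_ncard fun f hf => ?_).trans
    (Set.ncard_insert_le e {f ∈ F \ {e} | tail f ∉ X ∧ head f ∈ X})
  by_cases hfe : f = e
  · exact Or.inl hfe
  · exact Or.inr ⟨⟨hf.1, hfe⟩, hf.2⟩

lemma rho_sdiff_singleton_of_not_entering {F : Set E} {X : Set α} {e : E}
    (he : ¬ (tail e ∉ X ∧ head e ∈ X)) : rho tail head (F \ {e}) X = rho tail head F X := by
  unfold rho
  congr 1
  ext f
  refine ⟨fun hf => ⟨hf.1.1, hf.2⟩, fun hf => ⟨⟨hf.1, ?_⟩, hf.2⟩⟩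
  rintro rfl
  exact he hf.2

/-- The extension step of Lovász's proof of Edmonds' branching theorem. -/
lemma IsArborescenceOn.exists_extending_edge [Finite α] [Finite E] {F : Set E} {k : ℕ}
    (hF : ∀ X : Set α, X.Nonempty → r ∉ X → k + 1 ≤ rho tail head F X)
    {U : Set α} {B : Set E} (h : IsArborescenceOn tail head r U B)
    (hB : ∀ X : Set α, X.Nonempty → r ∉ X → k ≤ rho tail head (F \ B) X) (hU : U ≠ Set.univ) :
    ∃ e ∈ F, tail e ∈ U ∧ head e ∉ U ∧
      ∀ X : Set α, X.Nonempty → r ∉ X → k ≤ rho tail head (F \ insert e B) X := by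
  by_cases htight : ∃ X : Set α, r ∉ X ∧ (X \ U).Nonempty ∧ rho tail head (F \ B) X = k
  · obtain ⟨X, ⟨hrX, hXU, hXk⟩, hmin⟩ := Set.Finite.exists_minimal (Set.toFinite
      {X : Set α | r ∉ X ∧ (X \ U).Nonempty ∧ rho tail head (F \ B) X = k}) htight
    have hlt : rho tail head (F \ B) X < rho tail head F (X \ U) :=
      hXk ▸ hF _ hXU fun hr => hrX hr.1
    obtain ⟨e, ⟨heF, het, heh⟩, heX⟩ := Set.exists_mem_notMem_of_ncard_lt_ncard hlt
    have heB : e ∉ B := fun he => heh.2 (h.head_mem e he)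
    have htX : tail e ∈ X := by
      by_contra htX
      exact heX ⟨⟨heF, heB⟩, htX, heh.1⟩
    have htU : tail e ∈ U := by
      by_contra htU
      exact het ⟨htX, htU⟩
    refine ⟨e, heF, htU, heh.2, fun Y hY hrY => ?_⟩
    rw [← Set.union_singleton, ← Set.sdiff_sdiff]
    by_cases heY : tail e ∉ Y ∧ head e ∈ Y
    · have hne : rho tail head (F \ B) Y ≠ k := by
        intro hYk
        have hsub := rho_inter_add_rho_union_le (tail := tail) (head := head) (F \ B) X Y
        have h1 := hB (X ∩ Y) ⟨head e, heh.1, heY.2⟩ fun hr => hrX hr.1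
        have h2 := hB (X ∪ Y) ⟨head e, Or.inl heh.1⟩ fun hr => hr.elim hrX hrY
        exact heY.1 (hmin (y := X ∩ Y) ⟨fun hr => hrX hr.1,
          ⟨head e, ⟨heh.1, heY.2⟩, heh.2⟩, by omega⟩ Set.inter_subset_left htX).2
      have h1 := hB Y hY hrY
      have h2 := rho_le_rho_sdiff_singleton_add_one (tail := tail) (head := head) (F \ B) Y e
      omega
    · rw [rho_sdiff_singleton_of_not_entering heY]
      exact hB Y hY hrY
  · have hpos : 0 < rho tail head F Uᶜ :=
      (Nat.succ_pos k).trans_le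
        (hF _ (Set.nonempty_compl.2 hU) fun hr => hr h.root_mem)
    obtain ⟨e, heF, het, heh⟩ := (Set.ncard_pos).1 hpos
    refine ⟨e, heF, not_not.1 het, heh, fun Y hY hrY => ?_⟩
    rw [← Set.union_singleton, ← Set.sdiff_sdiff]
    by_cases heY : tail e ∉ Y ∧ head e ∈ Y
    · have hne : rho tail head (F \ B) Y ≠ k := fun hYk =>
        htight ⟨Y, hrY, ⟨head e, heY.2, heh⟩, hYk⟩
      have h1 := hB Y hY hrY
      have h2 := rho_le_rho_sdiff_singleton_add_one (tail := tail) (head := head) (F \ B) Y e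
      omega
    · rw [rho_sdiff_singleton_of_not_entering heY]
      exact hB Y hY hrY

lemma exists_isArborescenceOn_univ [Finite α] [Finite E] {F : Set E} {k : ℕ}
    (hF : ∀ X : Set α, X.Nonempty → r ∉ X → k + 1 ≤ rho tail head F X) :
    ∃ B ⊆ F, IsArborescenceOn tail head r Set.univ B ∧
      ∀ X : Set α, X.Nonempty → r ∉ X → k ≤ rho tail head (F \ B) X := by
  obtain ⟨U, ⟨B, hBF, hBU, hB⟩, hmax⟩ := Set.Finite.exists_maximal (Set.toFinite
    {U : Set α | ∃ B ⊆ F, IsArborescenceOn tail head r U B ∧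
      ∀ X : Set α, X.Nonempty → r ∉ X → k ≤ rho tail head (F \ B) X})
    ⟨{r}, ∅, Set.empty_subset F, isArborescenceOn_singleton_root, fun X hX hrX => by
      rw [Set.sdiff_empty]
      exact (Nat.le_succ k).trans (hF X hX hrX)⟩
  by_cases hU : U = Set.univ
  · exact ⟨B, hBF, hU ▸ hBU, hB⟩
  · obtain ⟨e, heF, het, heh, heB⟩ := hBU.exists_extending_edge hF hB hU
    exact (heh (hmax ⟨insert e B, Set.insert_subset heF hBF, hBU.insert_edge het heh, heB⟩
      (Set.subset_insert _ _) (Set.mem_insert _ _))).elim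

/-- Edmonds' disjoint arborescences theorem. -/
theorem exists_disjoint_isArborescenceOn_univ [Finite α] [Finite E] (k : ℕ) :
    ∀ F : Set E, (∀ X : Set α, X.Nonempty → r ∉ X → k ≤ rho tail head F X) →
      ∃ B : Fin k → Set E, (∀ i, B i ⊆ F) ∧ (∀ i j, i ≠ j → Disjoint (B i) (B j)) ∧
        ∀ i, IsArborescenceOn tail head r Set.univ (B i) := by
  induction k with
  | zero => exact fun F _ => ⟨Fin.elim0, fun i => i.elim0, fun i => i.elim0, fun i => i.elim0⟩
  | succ k ih =>
    intro F hF
    obtain ⟨A, hAF, hA, hFA⟩ := exists_isArborescenceOn_univ hF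
    obtain ⟨B, hBF, hdisj, hB⟩ := ih (F \ A) hFA
    have hAB : ∀ i, Disjoint A (B i) := fun i => Set.disjoint_sdiff_right.mono_right (hBF i)
    refine ⟨Fin.cons A B, Fin.cases hAF fun i => (hBF i).trans Set.sdiff_subset, ?_,
      Fin.cases hA hB⟩
    refine Fin.cases (Fin.cases (fun h => (h rfl).elim) fun j _ => hAB j) fun i =>
      Fin.cases (fun _ => (hAB i).symm) fun j hij => hdisj i j fun h => hij (h ▸ rfl)

lemma exists_entering_edge {X : Set α} : ∀ {p : List E} {e f : E},
    p.IsChain (fun e f => head e = tail f) → p.head? = some e → p.getLast? = some f →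
    tail e ∉ X → head f ∈ X → ∃ g ∈ p, tail g ∉ X ∧ head g ∈ X
  | [], _, _, _, he, _, _, _ => by simp at he
  | [a], _, _, _, he, hf, ht, hh => by
    simp only [List.head?_cons, List.getLast?_singleton, Option.some.injEq] at he hf
    subst he hf
    exact ⟨a, by simp, ht, hh⟩
  | a :: b :: p, e, f, hc, he, hf, ht, hh => by
    rw [List.isChain_cons_cons] at hc
    simp only [List.head?_cons, Option.some.injEq] at he
    rw [List.getLast?_cons_cons] at hf
    subst he
    by_cases ha : head a ∈ X
    · exact ⟨a, by simp, ht, ha⟩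
    · obtain ⟨g, hg, hgX⟩ := exists_entering_edge (p := b :: p) (e := b) hc.2 rfl hf
        (hc.1 ▸ ha) hh
      exact ⟨g, List.mem_cons_of_mem _ hg, hgX⟩

lemma HasEDPaths.le_rho [Finite E] {F : Set E} {v : α} {n : ℕ}
    (h : HasEDPaths tail head F r v n) {X : Set α} (hr : r ∉ X) (hv : v ∈ X) :
    n ≤ rho tail head F X := by
  obtain ⟨P, hP, hdisj⟩ := h
  have hex : ∀ i, ∃ g ∈ P i, tail g ∉ X ∧ head g ∈ X := fun i => by
    obtain ⟨-, hc, -, -, ⟨e, he, rfl⟩, f, hf, rfl⟩ := hP i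
    exact exists_entering_edge hc he hf hr hv
  choose g hgP hgX using hex
  have hinj : Function.Injective g := fun i j hij => by
    by_contra hne
    exact hdisj i j hne (g i) (hgP i) (hij ▸ hgP j)
  calc n = (Set.range g).ncard := by rw [Set.ncard_range_of_injective hinj, Nat.card_fin]
    _ ≤ rho tail head F X := Set.ncard_le_ncard (t := {e ∈ F | tail e ∉ X ∧ head e ∈ X})
      (Set.range_subset_iff.2 fun i => ⟨(hP i).1 _ (hgP i), hgX i⟩)

lemma hasEDPaths_lam {F : Set E} {v : α} (h : 1 ≤ lam tail head F r v) :
    HasEDPaths tail head F r v (lam tail head F r v) := by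
  have hbdd : BddAbove {n | HasEDPaths tail head F r v n} := by
    by_contra hbdd
    rw [lam, Nat.sSup_of_not_bddAbove hbdd] at h
    omega
  refine Nat.sSup_mem (Set.nonempty_iff_ne_empty.2 fun hempty => ?_) hbdd
  rw [lam, hempty, csSup_empty] at h
  exact absurd h (by simp)

end Edmonds

/-- if `F` is a flame with `ϱ_F(v) = k ≥ 1` for every `v ∈ V`
(and, as is implicit, no edge enters the root `r`), then its edge set is the
union of `k` pairwise edge-disjoint spanning arborescences rooted at `r`:
edge sets without (undirected) cycles in which every `v ∈ V` is entered exactly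
once and `r` is entered by no edge. -/
theorem flame_constant_indegree_arborescences
    {α E : Type*} [Fintype α] [Fintype E] (tail head : E → α) (r : α)
    (k : ℕ) (hk : 1 ≤ k)
    (hflame : IsFlame tail head Set.univ r)
    (hr : inDeg head Set.univ r = 0)
    (hdeg : ∀ v, v ≠ r → inDeg head Set.univ v = k) :
    ∃ B : Fin k → Set E,
      (∀ i j, i ≠ j → Disjoint (B i) (B j)) ∧
      (⋃ i, B i) = Set.univ ∧
      ∀ i, (∀ v, v ≠ r → inDeg head (B i) v = 1) ∧
        inDeg head (B i) r = 0 ∧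
        ∀ p : List E, ¬ IsDicycle tail head (B i) p := by
  obtain ⟨B, -, hdisj, hB⟩ := exists_disjoint_isArborescenceOn_univ (tail := tail) (head := head)
    (r := r) k Set.univ fun X ⟨v, hv⟩ hrX => by
      have hvr : v ≠ r := fun h => hrX (h ▸ hv)
      have hlam : lam tail head Set.univ r v = k := (hflame v hvr).trans (hdeg v hvr)
      exact (hlam ▸ hasEDPaths_lam (hlam.symm ▸ hk)).le_rho hrX hv
  refine ⟨B, hdisj, Set.eq_univ_of_forall fun e => ?_, fun i =>
    ⟨fun v hv => (hB i).inDeg_eq_one (Set.mem_univ v) hv, (hB i).inDeg_root,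
      (hB i).not_isDicycle⟩⟩
  have her : head e ≠ r := fun her => by
    rw [inDeg, Set.ncard_eq_zero] at hr
    exact Set.eq_empty_iff_forall_notMem.1 hr e ⟨Set.mem_univ e, her⟩
  choose b hb _ using fun i => (hB i).existsUnique_edge (head e) (Set.mem_univ _) her
  have hinj : Function.Injective b := fun i j hij => by
    by_contra hne
    exact Set.disjoint_left.1 (hdisj i j hne) (hb i).1 (hij ▸ (hb j).1)
  have hrange : Set.range b = {f ∈ Set.univ | head f = head e} := by
    refine Set.eq_of_subset_of_ncard_le
      (Set.range_subset_iff.2 fun i => ⟨Set.mem_univ _, (hb i).2⟩) ?_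
    rw [Set.ncard_range_of_injective hinj, Nat.card_fin]
    exact (hdeg _ her).le
  obtain ⟨i, rfl⟩ : e ∈ Set.range b := by rw [hrange]; exact ⟨Set.mem_univ e, rfl⟩
  exact Set.mem_iUnion.2 ⟨i, (hb i).1⟩
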